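/- arXiv:1105.1628 — 2 statements merged into one kernel-verified Lean document; each statement's English description precedes it below -/
import Mathlib

section
/- Let N ⊆ ℕ be a set of positive density. Then N is extremal if and only if N is B²-almost periodic. -/
open MeasureTheory Filter Finset
open scoped Classical

/-- `e t = exp(2πit)`. -/
noncomputable def e (t : ℝ) : ℂ := Complex.exp (2 * Real.pi * Complex.I * t)

/-- `N` has (natural) density `ρ`. -/
def HasDensity (N : Set ℕ) (ρ : ℝ) : Prop :=
  Filter.Tendsto (fun x : ℕ => (((Finset.Icc 1 x).filter (fun n => n ∈ N)).card : ℝ) / x)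
    Filter.atTop (nhds ρ)

/-- `N` has density `d` in the residue class `a` modulo `q`. -/
def HasResidueDensity (N : Set ℕ) (q a : ℕ) (d : ℝ) : Prop :=
  Filter.Tendsto (fun x : ℕ =>
      (((Finset.Icc 1 x).filter (fun n => n ∈ N ∧ n % q = a % q)).card : ℝ) / x)
    Filter.atTop (nhds d)

/-- `N` is distributed: all residue class densities exist. -/
def Distributed (N : Set ℕ) : Prop := ∀ q, 1 ≤ q → ∀ a, ∃ d, HasResidueDensity N q a d

/-- The singular series `∑_{q≥1} ∑_{(a,q)=1} |∑_{b=1}^q (F(q,b)/ρ) e(ab/q)|²`. -/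
noncomputable def extremalSum (F : ℕ → ℕ → ℝ) (ρ : ℝ) : ℝ :=
  ∑' q : ℕ, ∑ a ∈ (Finset.Icc 1 q).filter (fun a => Nat.Coprime a q),
    ‖∑ b ∈ Finset.Icc 1 q, ((F q b / ρ : ℝ) : ℂ) * e (((a : ℝ) * b) / q)‖ ^ 2

/-- `N` is extremal. -/
def Extremal (N : Set ℕ) : Prop :=
  ∃ ρ : ℝ, 0 < ρ ∧ HasDensity N ρ ∧
    ∃ F : ℕ → ℕ → ℝ, (∀ q, 1 ≤ q → ∀ a, HasResidueDensity N q a (F q a)) ∧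
      1 / ρ = extremalSum F ρ

/-- `S(θ) = ∑_{n ≤ x, n ∈ N} e(θn)`. -/
noncomputable def expSum (N : Set ℕ) (x : ℕ) (θ : ℝ) : ℂ :=
  ∑ n ∈ (Finset.Icc 1 x).filter (fun n => n ∈ N), e (θ * n)

/-- Rational major arcs `M(x,Q)`. -/
def majorArcs (x Q : ℕ) : Set ℝ :=
  ⋃ q ∈ Finset.Icc 1 Q, ⋃ a ∈ (Finset.Icc 1 q).filter (fun a => Nat.Coprime a q),
    Set.Icc ((a : ℝ) / q - Q / x) ((a : ℝ) / q + Q / x)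

/-- Rational minor arcs `m(x,Q) = [0,1] \ M(x,Q)`. -/
def minorArcs (x Q : ℕ) : Set ℝ := Set.Icc 0 1 \ majorArcs x Q

/-- Characteristic function of a set of naturals. -/
noncomputable def charFun (N : Set ℕ) : ℕ → ℂ := fun n => if n ∈ N then 1 else 0

/-- A (nonconstant-period) periodic function on `ℕ`. -/
def IsPeriodicFn (g : ℕ → ℂ) : Prop := ∃ p : ℕ, 1 ≤ p ∧ ∀ n, g (n + p) = g n

/-- Trigonometric polynomials `n ↦ ∑ a_ν e(α_ν n)`. -/
def IsTrigPoly (g : ℕ → ℂ) : Prop :=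
  ∃ (k : ℕ) (a : Fin k → ℂ) (α : Fin k → ℝ), ∀ n : ℕ, g n = ∑ ν : Fin k, a ν * e (α ν * n)

/-- The seminorm `‖f‖₂ = (limsup_x (1/x) ∑_{n≤x} |f n|²)^{1/2}`. -/
noncomputable def seminorm2 (f : ℕ → ℂ) : ℝ :=
  Real.sqrt (Filter.limsup (fun x : ℕ => (∑ n ∈ Finset.Icc 1 x, ‖f n‖ ^ 2) / x) Filter.atTop)

/-- `f` lies in `A²`, the `‖·‖₂`-closure of the trigonometric polynomials. -/
def MemA2 (f : ℕ → ℂ) : Prop :=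
  ∀ ε : ℝ, 0 < ε → ∃ g : ℕ → ℂ, IsTrigPoly g ∧ seminorm2 (fun n => f n - g n) < ε

/-- `f` lies in `B²`, the `‖·‖₂`-closure of the periodic functions. -/
def MemB2 (f : ℕ → ℂ) : Prop :=
  ∀ ε : ℝ, 0 < ε → ∃ g : ℕ → ℂ, IsPeriodicFn g ∧ seminorm2 (fun n => f n - g n) < ε

/-- `f` is `B²`-almost periodic: there is a sequence of periodic functions `fq` with
`limsup_x (1/x) ∑_{n≤x} |f n - fq n|² → 0`. -/
def B2AlmostPeriodic (f : ℕ → ℂ) : Prop :=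
  ∃ fq : ℕ → ℕ → ℂ, (∀ q, IsPeriodicFn (fq q)) ∧
    Filter.Tendsto (fun q : ℕ =>
        Filter.limsup (fun x : ℕ => (∑ n ∈ Finset.Icc 1 x, ‖f n - fq q n‖ ^ 2) / x)
          Filter.atTop)
      Filter.atTop (nhds 0)

/-- The Fourier coefficient `⟨f, e_β⟩ = lim_x (1/x) ∑_{n≤x} f n e(-βn)` equals `c`. -/
def HasFourierCoeff (f : ℕ → ℂ) (β : ℝ) (c : ℂ) : Prop :=
  Filter.Tendsto (fun x : ℕ => (∑ n ∈ Finset.Icc 1 x, f n * e (-(β * n))) / (x : ℂ))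
    Filter.atTop (nhds c)

/-- The spectrum of `f`: those `β` with nonzero Fourier coefficient. -/
def spec (f : ℕ → ℂ) : Set ℝ := {β | ∃ c : ℂ, c ≠ 0 ∧ HasFourierCoeff f β c}

/-- Major arcs `M_α(x,Q)` relative to a sequence `α`. -/
def majorArcsAlpha (α : ℕ → ℝ) (x Q : ℕ) : Set ℝ :=
  ⋃ n : ℕ, ⋃ _ : n ≤ Q, Set.Icc (α n - Q / x) (α n + Q / x)

/-- Minor arcs `m_α(x,Q) = [0,1] \ M_α(x,Q)`. -/
def minorArcsAlpha (α : ℕ → ℝ) (x Q : ℕ) : Set ℝ := Set.Icc 0 1 \ majorArcsAlpha α x Q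

/-- `N` is `α`-extremal: it has positive density, all Fourier coefficients of its
characteristic function exist, and `∫_{m_α(x,Q(x))} |S|² = o(x)` for every `Q(x) → ∞`. -/
def AlphaExtremal (N : Set ℕ) (α : ℕ → ℝ) : Prop :=
  (∃ ρ : ℝ, 0 < ρ ∧ HasDensity N ρ) ∧
  (∀ β : ℝ, ∃ c : ℂ, HasFourierCoeff (charFun N) β c) ∧
  ∀ Q : ℕ → ℕ, Filter.Tendsto Q Filter.atTop Filter.atTop →
    Filter.Tendsto (fun x : ℕ =>
        (∫ θ in minorArcsAlpha α x (Q x), ‖expSum N x θ‖ ^ 2) / x)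
      Filter.atTop (nhds 0)

lemma e_add (s t : ℝ) : e (s + t) = e s * e t := by
  simp only [e, ← Complex.exp_add]
  push_cast
  ring_nf

lemma e_natCast (n : ℕ) : e n = 1 := by
  rw [e, ← Complex.exp_nat_mul_two_pi_mul_I n]
  push_cast
  ring_nf

lemma e_natCast_mul (n : ℕ) (t : ℝ) : e (n * t) = e t ^ n := by
  rw [e, e, ← Complex.exp_nat_mul]
  push_cast
  ring_nf

lemma norm_e (t : ℝ) : ‖e t‖ = 1 := by
  have h : (2 * Real.pi * Complex.I * t : ℂ) = ((2 * Real.pi * t : ℝ) : ℂ) * Complex.I := by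
    push_cast
    ring
  rw [e, h, Complex.norm_exp_ofReal_mul_I]

lemma isPrimitiveRoot_e_inv {q : ℕ} (hq : 1 ≤ q) : IsPrimitiveRoot (e (1 / q : ℝ)) q := by
  have h := Complex.isPrimitiveRoot_exp q (by omega)
  convert h using 1
  rw [e]
  push_cast
  ring_nf

lemma periodic_e_div {a q : ℕ} (hq : 1 ≤ q) :
    Function.Periodic (fun n : ℕ => e ((a : ℝ) * n / q)) q := by
  intro n
  have hq' : (q : ℝ) ≠ 0 := by positivity
  have h : (a : ℝ) * ((n + q : ℕ) : ℝ) / q = (a : ℝ) * n / q + (a : ℕ) := by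
    push_cast
    field_simp
  simp only [h, e_add, e_natCast, mul_one]

/-- Every residue class modulo `p` has exactly one representative in `Icc 1 p`. -/
lemma exists_unique_residue {p : ℕ} (hp : 1 ≤ p) (n : ℕ) :
    ∃ r ∈ Icc 1 p, n % p = r % p ∧ ∀ b ∈ Icc 1 p, n % p = b % p → b = r := by
  have key : ∀ b ∈ Icc 1 p, ∀ r ∈ Icc 1 p, b % p = r % p → b = r := by
    intro b hb r hr h
    rw [Finset.mem_Icc] at hb hr
    refine Nat.ModEq.eq_of_abs_lt (m := p) h ?_
    rw [abs_lt]
    omega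
  have hlt := Nat.mod_lt n hp
  have ex : ∃ r ∈ Icc 1 p, n % p = r % p := by
    by_cases h : n % p = 0
    · exact ⟨p, by simp [hp], by simp [h]⟩
    · exact ⟨n % p, by rw [Finset.mem_Icc]; omega, by simp⟩
  obtain ⟨r, hr, h⟩ := ex
  exact ⟨r, hr, h, fun b hb hb' => key b hb r hr (hb'.symm.trans h)⟩

section MeanValues

variable {E : Type*} [NormedAddCommGroup E] [NormedSpace ℝ E]

lemma sum_filter_mem_eq_sum_residue {N : Set ℕ} {p : ℕ} (hp : 1 ≤ p) {w : ℕ → E}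
    (hw : Function.Periodic w p) (x : ℕ) :
    ∑ n ∈ (Icc 1 x).filter (· ∈ N), w n =
      ∑ b ∈ Icc 1 p,
        (((Icc 1 x).filter (fun n => n ∈ N ∧ n % p = b % p)).card : ℝ) • w b := by
  have hmod : ∀ {n b : ℕ}, n % p = b % p → w n = w b := by
    intro n b h
    rw [← hw.map_mod_nat n, h, hw.map_mod_nat]
  have h1 : ∀ b, (((Icc 1 x).filter (fun n => n ∈ N ∧ n % p = b % p)).card : ℝ) • w b =
      ∑ n ∈ (Icc 1 x).filter (· ∈ N), if n % p = b % p then w n else 0 := by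
    intro b
    rw [← Finset.sum_filter, Finset.filter_filter, Finset.sum_congr rfl
      (g := fun _ => w b) (fun n hn => hmod (Finset.mem_filter.mp hn).2.2), Finset.sum_const,
      Nat.cast_smul_eq_nsmul]
  simp only [h1]
  rw [Finset.sum_comm]
  refine Finset.sum_congr rfl fun n _ => ?_
  obtain ⟨r, hr, hnr, huniq⟩ := exists_unique_residue hp n
  rw [Finset.sum_eq_single r, if_pos hnr]
  · intro b hb hbr
    exact if_neg fun h => hbr (huniq b hb h)
  · exact fun h => absurd hr h

/-- Mean value over `N` of a periodic function. -/
lemma tendsto_mean_of_periodic {N : Set ℕ} {p : ℕ} (hp : 1 ≤ p) {d : ℕ → ℝ}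
    (hd : ∀ a, HasResidueDensity N p a (d a)) {w : ℕ → E} (hw : Function.Periodic w p) :
    Tendsto (fun x : ℕ => (x : ℝ)⁻¹ • ∑ n ∈ (Icc 1 x).filter (· ∈ N), w n) atTop
      (nhds (∑ b ∈ Icc 1 p, d b • w b)) := by
  simp only [sum_filter_mem_eq_sum_residue hp hw, Finset.smul_sum, smul_smul]
  refine tendsto_finsetSum _ fun b _ => Tendsto.smul_const ?_ _
  refine (hd b).congr fun x => ?_
  rw [div_eq_inv_mul]

lemma hasResidueDensity_univ {p : ℕ} (hp : 1 ≤ p) (a : ℕ) :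
    HasResidueDensity Set.univ p a (1 / p) := by
  have hp' : (0 : ℚ) < p := by positivity
  have hbound : ∀ x : ℕ, |(((Icc 1 x).filter
      (fun n => n ∈ (Set.univ : Set ℕ) ∧ n % p = a % p)).card : ℝ) * p - x| ≤ p := by
    intro x
    have hcard := Nat.Ioc_filter_modEq_card 0 x (r := p) (by omega) a
    have hset : (Icc 1 x).filter (fun n => n ∈ (Set.univ : Set ℕ) ∧ n % p = a % p) =
        (Ioc 0 x).filter (fun n => n ≡ a [MOD p]) := by
      ext n
      simp only [Finset.mem_filter, Finset.mem_Icc, Finset.mem_Ioc, Set.mem_univ, true_and]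
      rfl
    have hle : ((0 : ℕ) - a : ℚ) / p ≤ ((x : ℚ) - a) / p := by
      gcongr
      simp
    rw [max_eq_left (sub_nonneg.mpr (Int.floor_le_floor hle))] at hcard
    have h1 := Int.floor_le (((x : ℚ) - a) / p)
    have h2 := Int.lt_floor_add_one (((x : ℚ) - a) / p)
    have h3 := Int.floor_le (((0 : ℕ) - a : ℚ) / p)
    have h4 := Int.lt_floor_add_one (((0 : ℕ) - a : ℚ) / p)
    have hcard' := congrArg (Int.cast : ℤ → ℚ) hcard
    push_cast at hcard' h1 h2 h3 h4
    rw [le_div_iff₀ hp'] at h1 h3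
    rw [div_lt_iff₀ hp'] at h2 h4
    have hq : |((#{n ∈ Ioc 0 x | n ≡ a [MOD p]} : ℕ) : ℚ) * p - x| ≤ p := by
      rw [hcard', abs_le]
      constructor <;> nlinarith
    rw [hset]
    exact_mod_cast hq
  rw [HasResidueDensity, tendsto_iff_dist_tendsto_zero]
  refine squeeze_zero' (.of_forall fun _ => dist_nonneg) ?_ tendsto_one_div_atTop_nhds_zero_nat
  filter_upwards [eventually_gt_atTop 0] with x hx
  have hx' : (0 : ℝ) < x := by positivity
  have hpr : (0 : ℝ) < p := by positivity
  rw [Real.dist_eq, div_sub_div _ _ hx'.ne' hpr.ne', mul_one, abs_div,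
    abs_of_pos (mul_pos hx' hpr), div_le_div_iff₀ (by positivity) hx']
  rw [one_mul, mul_comm (x : ℝ) p]
  simpa using mul_le_mul_of_nonneg_right (hbound x) hx'.le

/-- Mean value of a periodic function. -/
lemma tendsto_mean_of_periodic_univ {p : ℕ} (hp : 1 ≤ p) {w : ℕ → E}
    (hw : Function.Periodic w p) :
    Tendsto (fun x : ℕ => (x : ℝ)⁻¹ • ∑ n ∈ Icc 1 x, w n) atTop
      (nhds (∑ b ∈ Icc 1 p, (1 / p : ℝ) • w b)) := by
  simpa using tendsto_mean_of_periodic hp (hasResidueDensity_univ hp) hw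

end MeanValues

/-- Parseval's identity on the cyclic group of order `q`. -/
lemma sum_norm_sq_expSum_eq {q : ℕ} (hq : 1 ≤ q) (f : ℕ → ℝ) :
    ∑ a ∈ Icc 1 q, ‖∑ b ∈ Icc 1 q, (f b : ℂ) * e ((a : ℝ) * b / q)‖ ^ 2 =
      q * ∑ b ∈ Icc 1 q, f b ^ 2 := by
  have hζ := isPrimitiveRoot_e_inv hq
  set ζ := e (1 / q : ℝ) with hζdef
  have hζ0 : ζ ≠ 0 := hζ.ne_zero (by omega)
  have hconj : (starRingEnd ℂ) ζ = ζ⁻¹ := by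
    rw [Complex.inv_def, Complex.normSq_eq_norm_sq, norm_e]
    simp
  have hpow : ∀ a b : ℕ, e ((a : ℝ) * b / q) = ζ ^ (a * b) := by
    intro a b
    rw [hζdef, ← e_natCast_mul]
    push_cast
    ring_nf
  have horth : ∀ b ∈ Icc 1 q, ∀ c ∈ Icc 1 q,
      ∑ a ∈ Icc 1 q, (ζ ^ b * (ζ⁻¹) ^ c) ^ a = if b = c then (q : ℂ) else 0 := by
    intro b hb c hc
    split_ifs with h
    · subst h
      simp [hζ0]
    · have hz : ζ ^ b * (ζ⁻¹) ^ c ≠ 1 := by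
        intro hz
        rw [inv_pow, mul_inv_eq_one₀ (pow_ne_zero _ hζ0)] at hz
        have hm : b % q = c % q := by
          rcases le_total b c with hbc | hbc
          · have h1 : ζ ^ (c - b) = 1 := by
              rw [pow_sub₀ _ hζ0 hbc, hz, mul_inv_cancel₀ (by simp [hζ0])]
            exact (Nat.modEq_iff_dvd' hbc).mpr (hζ.dvd_of_pow_eq_one _ h1)
          · have h1 : ζ ^ (b - c) = 1 := by
              rw [pow_sub₀ _ hζ0 hbc, hz, mul_inv_cancel₀ (by simp [hζ0])]
            exact ((Nat.modEq_iff_dvd' hbc).mpr (hζ.dvd_of_pow_eq_one _ h1)).symm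
        obtain ⟨r, -, -, huniq⟩ := exists_unique_residue hq b
        exact h ((huniq b hb rfl).trans (huniq c hc hm).symm)
      have hzq : (ζ ^ b * (ζ⁻¹) ^ c) ^ q = 1 := by
        rw [mul_pow, ← pow_mul, ← pow_mul, mul_comm b, mul_comm c, pow_mul, pow_mul, inv_pow,
          hζ.pow_eq_one]
        simp
      have hg := geom_sum_eq hz q
      rw [hzq, sub_self, zero_div] at hg
      have hIcc : Icc 1 q = Ico 1 (q + 1) := by ext; simp
      rw [hIcc, Finset.sum_Ico_eq_sum_range, Nat.add_sub_cancel]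
      simp only [pow_add, pow_one, ← Finset.mul_sum, hg, mul_zero]
  apply Complex.ofReal_injective
  push_cast
  simp only [← Complex.mul_conj', map_sum, map_mul, Complex.conj_ofReal, hpow, map_pow, hconj,
    Finset.sum_mul_sum]
  rw [Finset.sum_comm, Finset.mul_sum]
  refine Finset.sum_congr rfl fun b hb => ?_
  rw [Finset.sum_comm]
  have : ∀ c ∈ Icc 1 q, ∑ a ∈ Icc 1 q, (f b : ℂ) * ζ ^ (a * b) * ((f c : ℂ) * ζ⁻¹ ^ (a * c)) =
      if b = c then (q : ℂ) * (f b * f c) else 0 := by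
    intro c hc
    have h := horth b hb c hc
    have h2 : ∀ a, (f b : ℂ) * ζ ^ (a * b) * ((f c : ℂ) * ζ⁻¹ ^ (a * c)) =
        f b * f c * (ζ ^ b * (ζ⁻¹) ^ c) ^ a := by
      intro a
      rw [mul_pow, ← pow_mul, ← pow_mul, mul_comm b, mul_comm c]
      ring
    simp only [h2, ← Finset.mul_sum, h]
    split_ifs
    · ring
    · simp
  rw [Finset.sum_congr rfl this, Finset.sum_ite_eq, if_pos hb]
  ring

/-- Fractions with denominator `Q`, sorted by their reduced denominator. -/
lemma sum_Icc_eq_sum_divisors_coprime {Q : ℕ} (hQ : 1 ≤ Q) {φ : ℕ → ℕ → ℝ}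
    (hφ : ∀ g a q, 1 ≤ g → 1 ≤ q → φ (g * q) (g * a) = φ q a) :
    ∑ a ∈ Icc 1 Q, φ Q a =
      ∑ q ∈ Q.divisors, ∑ a ∈ (Icc 1 q).filter (fun a => Nat.Coprime a q), φ q a := by
  rw [Finset.sum_sigma']
  symm
  refine Finset.sum_bij' (fun s _ => Q / s.1 * s.2) (fun a _ => ⟨Q / Nat.gcd a Q, a / Nat.gcd a Q⟩)
    ?_ ?_ ?_ ?_ ?_
  · rintro ⟨q, a⟩ h
    simp only [Finset.mem_sigma, Nat.mem_divisors, Finset.mem_filter, Finset.mem_Icc] at h ⊢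
    obtain ⟨⟨⟨k, rfl⟩, -⟩, ⟨h1, h2⟩, h3⟩ := h
    have hq : 0 < q := by omega
    rw [Nat.mul_div_cancel_left _ hq]
    have hk : 0 < k := Nat.pos_of_ne_zero (by rintro rfl; simp at hQ)
    exact ⟨Nat.mul_pos hk h1, by rw [mul_comm q]; exact Nat.mul_le_mul_left k h2⟩
  · intro a h
    rw [Finset.mem_Icc] at h
    have hg : 0 < Nat.gcd a Q := Nat.gcd_pos_of_pos_left _ h.1
    simp only [Finset.mem_sigma, Nat.mem_divisors, Finset.mem_filter, Finset.mem_Icc]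
    refine ⟨⟨Nat.div_dvd_of_dvd (Nat.gcd_dvd_right _ _), by omega⟩, ⟨?_, ?_⟩, ?_⟩
    · exact Nat.div_pos (Nat.le_of_dvd h.1 (Nat.gcd_dvd_left _ _)) hg
    · exact Nat.div_le_div_right h.2
    · exact Nat.coprime_div_gcd_div_gcd hg
  · rintro ⟨q, a⟩ h
    simp only [Finset.mem_sigma, Nat.mem_divisors, Finset.mem_filter, Finset.mem_Icc] at h ⊢
    obtain ⟨⟨⟨k, rfl⟩, -⟩, ⟨h1, h2⟩, h3⟩ := h
    have hq : 0 < q := by omega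
    have hk : 0 < k := Nat.pos_of_ne_zero (by rintro rfl; simp at hQ)
    rw [Nat.mul_div_cancel_left _ hq, mul_comm q, Nat.gcd_mul_left, h3, mul_one,
      Nat.mul_div_cancel_left _ hk, Nat.mul_div_cancel_left _ hk]
  · intro a h
    rw [Finset.mem_Icc] at h
    dsimp only
    rw [Nat.div_div_self (Nat.gcd_dvd_right _ _) (by omega),
      Nat.mul_div_cancel' (Nat.gcd_dvd_left _ _)]
  · rintro ⟨q, a⟩ h
    simp only [Finset.mem_sigma, Nat.mem_divisors, Finset.mem_filter, Finset.mem_Icc] at h ⊢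
    obtain ⟨⟨⟨k, rfl⟩, -⟩, ⟨h1, h2⟩, h3⟩ := h
    have hq : 0 < q := by omega
    have hk : 0 < k := Nat.pos_of_ne_zero (by rintro rfl; simp at hQ)
    rw [Nat.mul_div_cancel_left _ hq, mul_comm q, hφ k a q hk hq]

/-- The energy `q ∑_b F(q,b)²` of the density profile of a set modulo `q`. -/
noncomputable def residueEnergy (F : ℕ → ℕ → ℝ) (q : ℕ) : ℝ := q * ∑ b ∈ Icc 1 q, F q b ^ 2

/-- The contribution of the primitive frequencies `a / q` to the Fourier energy. -/
noncomputable def primitiveEnergy (F : ℕ → ℕ → ℝ) (q : ℕ) : ℝ :=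
  ∑ a ∈ (Icc 1 q).filter (fun a => Nat.Coprime a q),
    ‖∑ b ∈ Icc 1 q, (F q b : ℂ) * e ((a : ℝ) * b / q)‖ ^ 2

lemma primitiveEnergy_nonneg (F : ℕ → ℕ → ℝ) (q : ℕ) : 0 ≤ primitiveEnergy F q :=
  Finset.sum_nonneg fun _ _ => sq_nonneg _

lemma extremalSum_eq (F : ℕ → ℕ → ℝ) (ρ : ℝ) :
    extremalSum F ρ = (∑' q, primitiveEnergy F q) / ρ ^ 2 := by
  rw [extremalSum, ← tsum_div_const]
  congr 1
  ext q
  rw [primitiveEnergy, Finset.sum_div]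
  refine Finset.sum_congr rfl fun a _ => ?_
  have : ∑ b ∈ Icc 1 q, ((F q b / ρ : ℝ) : ℂ) * e ((a : ℝ) * b / q) =
      (∑ b ∈ Icc 1 q, (F q b : ℂ) * e ((a : ℝ) * b / q)) / (ρ : ℂ) := by
    rw [Finset.sum_div]
    refine Finset.sum_congr rfl fun b _ => ?_
    push_cast
    ring
  rw [this, norm_div, div_pow, Complex.norm_real, Real.norm_eq_abs, sq_abs]

section Densities

variable {N : Set ℕ} {ρ : ℝ} {F : ℕ → ℕ → ℝ}

lemma residueEnergy_eq_sum_divisors (hF : ∀ q, 1 ≤ q → ∀ a, HasResidueDensity N q a (F q a))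
    {Q : ℕ} (hQ : 1 ≤ Q) : residueEnergy F Q = ∑ q ∈ Q.divisors, primitiveEnergy F q := by
  rw [residueEnergy, ← sum_norm_sq_expSum_eq hQ]
  refine sum_Icc_eq_sum_divisors_coprime hQ
    (φ := fun q a => ‖∑ b ∈ Icc 1 q, (F q b : ℂ) * e ((a : ℝ) * b / q)‖ ^ 2) ?_
  intro g a q hg hq
  have hgq : 1 ≤ g * q := Nat.mul_pos hg hq
  have h1 := tendsto_mean_of_periodic hq (hF q hq) (periodic_e_div (a := a) hq)
  have h2 := tendsto_mean_of_periodic hgq (hF _ hgq) (periodic_e_div (a := g * a) hgq)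
  have hfrac : ∀ n : ℕ, ((g * a : ℕ) : ℝ) * n / ((g * q : ℕ) : ℝ) = (a : ℝ) * n / q := by
    intro n
    have : (g : ℝ) ≠ 0 := by positivity
    push_cast
    rw [mul_assoc, mul_div_mul_left _ _ this]
  simp only [hfrac] at h2 ⊢
  have := tendsto_nhds_unique h2 h1
  simp only [Complex.real_smul] at this
  rw [this]

/-- The mean square distance from the indicator of `N` to a periodic function. -/
lemma tendsto_mean_sq_sub {p : ℕ} (hp : 1 ≤ p) {d : ℕ → ℝ}
    (hd : ∀ a, HasResidueDensity N p a (d a)) {h : ℕ → ℂ} (hh : Function.Periodic h p) :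
    Tendsto (fun x : ℕ => (∑ n ∈ Icc 1 x, ‖charFun N n - h n‖ ^ 2) / x) atTop
      (nhds (∑ b ∈ Icc 1 p, (d b * (1 - 2 * (h b).re) + 1 / p * ‖h b‖ ^ 2))) := by
  have h1 := tendsto_mean_of_periodic hp hd (w := fun n => 1 - 2 * (h n).re)
    (fun n => by simp only [hh n])
  have h2 := tendsto_mean_of_periodic_univ hp (w := fun n => ‖h n‖ ^ 2)
    (fun n => by simp only [hh n])
  have h3 := h1.add h2
  rw [← Finset.sum_add_distrib] at h3
  simp only [smul_eq_mul] at h3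
  refine h3.congr fun x => ?_
  rw [← mul_add, Finset.sum_filter, ← Finset.sum_add_distrib, div_eq_inv_mul]
  congr 1
  refine Finset.sum_congr rfl fun n _ => ?_
  rw [_root_.charFun]
  split_ifs
  · simp only [← Complex.normSq_eq_norm_sq, Complex.normSq_apply, Complex.sub_re, Complex.sub_im,
      Complex.one_re, Complex.one_im]
    ring
  · simp

lemma sum_residueDensity_eq (hρ : HasDensity N ρ) {p : ℕ} (hp : 1 ≤ p) {d : ℕ → ℝ}
    (hd : ∀ a, HasResidueDensity N p a (d a)) : ∑ b ∈ Icc 1 p, d b = ρ := by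
  have h1 := tendsto_mean_of_periodic hp hd (w := fun _ => (1 : ℝ)) (fun _ => rfl)
  refine tendsto_nhds_unique ?_ hρ
  simpa [div_eq_inv_mul] using h1

lemma residueDensity_periodic {p : ℕ} {d : ℕ → ℝ}
    (hd : ∀ a, HasResidueDensity N p a (d a)) : Function.Periodic d p := by
  intro n
  refine tendsto_nhds_unique (hd _) ?_
  have := hd n
  simpa [HasResidueDensity] using this

/-- Periodic functions of period `q` are at mean square distance at least `ρ - residueEnergy F q`. -/
lemma sub_residueEnergy_le_limsup (hρ : HasDensity N ρ)
    (hF : ∀ q, 1 ≤ q → ∀ a, HasResidueDensity N q a (F q a)) {q : ℕ} (hq : 1 ≤ q) {h : ℕ → ℂ}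
    (hh : Function.Periodic h q) :
    ρ - residueEnergy F q ≤
      limsup (fun x : ℕ => (∑ n ∈ Icc 1 x, ‖charFun N n - h n‖ ^ 2) / x) atTop := by
  rw [(tendsto_mean_sq_sub hq (hF q hq) hh).limsup_eq, ← sum_residueDensity_eq hρ hq (hF q hq),
    residueEnergy, Finset.mul_sum, ← Finset.sum_sub_distrib]
  refine Finset.sum_le_sum fun b _ => ?_
  have hq' : (0 : ℝ) < q := by positivity
  rw [← Complex.normSq_eq_norm_sq, Complex.normSq_apply]
  have key : 0 ≤ 1 / (q : ℝ) * (((h b).re - q * F q b) ^ 2 + (h b).im ^ 2) := by positivity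
  have : 1 / (q : ℝ) * (((h b).re - q * F q b) ^ 2 + (h b).im ^ 2) =
      F q b * (1 - 2 * (h b).re) + 1 / q * ((h b).re * (h b).re + (h b).im * (h b).im) -
        (F q b - q * F q b ^ 2) := by
    field_simp
    ring
  linarith

/-- The density profile modulo `q` is at mean square distance `ρ - residueEnergy F q`. -/
lemma tendsto_mean_sq_sub_profile (hρ : HasDensity N ρ)
    (hF : ∀ q, 1 ≤ q → ∀ a, HasResidueDensity N q a (F q a)) {q : ℕ} (hq : 1 ≤ q) :
    Tendsto (fun x : ℕ => (∑ n ∈ Icc 1 x, ‖charFun N n - ((q * F q n : ℝ) : ℂ)‖ ^ 2) / x) atTop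
      (nhds (ρ - residueEnergy F q)) := by
  have hper := residueDensity_periodic (hF q hq)
  have h := tendsto_mean_sq_sub hq (hF q hq) (h := fun n => ((q * F q n : ℝ) : ℂ))
    (fun n => by simp only [hper n])
  convert h using 2
  rw [← sum_residueDensity_eq hρ hq (hF q hq), residueEnergy, Finset.mul_sum,
    ← Finset.sum_sub_distrib]
  refine Finset.sum_congr rfl fun b _ => ?_
  have hq' : (q : ℝ) ≠ 0 := by positivity
  rw [Complex.ofReal_re, Complex.norm_real, Real.norm_eq_abs, sq_abs]
  field_simp
  ring

lemma residueEnergy_le (hρ : HasDensity N ρ)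
    (hF : ∀ q, 1 ≤ q → ∀ a, HasResidueDensity N q a (F q a)) {q : ℕ} (hq : 1 ≤ q) :
    residueEnergy F q ≤ ρ := by
  have := ge_of_tendsto' (tendsto_mean_sq_sub_profile hρ hF hq) (b := 0) fun x => by positivity
  linarith

lemma sum_primitiveEnergy_le (hF : ∀ q, 1 ≤ q → ∀ a, HasResidueDensity N q a (F q a))
    (s : Finset ℕ) : ∃ Q, 1 ≤ Q ∧ ∑ q ∈ s, primitiveEnergy F q ≤ residueEnergy F Q := by
  have hQ : 1 ≤ ∏ q ∈ s.erase 0, q :=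
    Finset.prod_pos fun q hq => Nat.pos_of_ne_zero (Finset.ne_of_mem_erase hq)
  refine ⟨_, hQ, ?_⟩
  have h0 : primitiveEnergy F 0 = 0 := by simp [primitiveEnergy]
  rw [residueEnergy_eq_sum_divisors hF hQ, ← Finset.sum_erase s h0]
  refine Finset.sum_le_sum_of_subset_of_nonneg ?_ fun q _ _ => primitiveEnergy_nonneg F q
  intro q hq
  rw [Nat.mem_divisors]
  exact ⟨Finset.dvd_prod_of_mem _ hq, by omega⟩

lemma summable_primitiveEnergy (hρ : HasDensity N ρ)
    (hF : ∀ q, 1 ≤ q → ∀ a, HasResidueDensity N q a (F q a)) :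
    Summable (primitiveEnergy F) := by
  refine summable_of_sum_le (c := ρ) (primitiveEnergy_nonneg F) fun s => ?_
  obtain ⟨Q, hQ, h⟩ := sum_primitiveEnergy_le hF s
  exact h.trans (residueEnergy_le hρ hF hQ)

lemma tsum_primitiveEnergy_eq_iff (hρ : HasDensity N ρ)
    (hF : ∀ q, 1 ≤ q → ∀ a, HasResidueDensity N q a (F q a)) :
    ∑' q, primitiveEnergy F q = ρ ↔
      ∀ ε > 0, ∃ Q, 1 ≤ Q ∧ ρ - residueEnergy F Q < ε := by
  have hs := summable_primitiveEnergy hρ hF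
  constructor
  · intro h ε hε
    have hsum := hs.hasSum
    rw [h] at hsum
    obtain ⟨s, hs'⟩ := (hsum.eventually (lt_mem_nhds (sub_lt_self ρ hε))).exists
    obtain ⟨Q, hQ, hle⟩ := sum_primitiveEnergy_le hF s
    exact ⟨Q, hQ, by linarith⟩
  · intro h
    refine le_antisymm (hs.tsum_le_of_sum_le fun s => ?_) ?_
    · obtain ⟨Q, hQ, hle⟩ := sum_primitiveEnergy_le hF s
      exact hle.trans (residueEnergy_le hρ hF hQ)
    · refine le_of_forall_pos_le_add fun ε hε => ?_
      obtain ⟨Q, hQ, hlt⟩ := h ε hε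
      have := hs.sum_le_tsum Q.divisors fun q _ => primitiveEnergy_nonneg F q
      rw [← residueEnergy_eq_sum_divisors hF hQ] at this
      linarith

end Densities

lemma exists_bound_of_periodic {h : ℕ → ℂ} {p : ℕ} (hp : 1 ≤ p) (hh : Function.Periodic h p) :
    ∃ C, ∀ n, ‖h n‖ ≤ C := by
  refine ⟨∑ b ∈ Finset.range p, ‖h b‖, fun n => ?_⟩
  rw [← hh.map_mod_nat n]
  exact Finset.single_le_sum (f := fun b => ‖h b‖) (fun _ _ => norm_nonneg _)
    (Finset.mem_range.mpr (Nat.mod_lt _ hp))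

/-- The mean square of a bounded sequence is eventually below any bound exceeding its limsup. -/
lemma eventually_mean_sq_lt {f : ℕ → ℂ} {C ε : ℝ} (hf : ∀ n, ‖f n‖ ≤ C)
    (h : limsup (fun x : ℕ => (∑ n ∈ Icc 1 x, ‖f n‖ ^ 2) / x) atTop < ε) :
    ∀ᶠ x : ℕ in atTop, (∑ n ∈ Icc 1 x, ‖f n‖ ^ 2) / x < ε := by
  refine eventually_lt_of_limsup_lt h (isBoundedUnder_of ⟨C ^ 2, fun x => ?_⟩)
  refine div_le_of_le_mul₀ (by positivity) (by positivity) ?_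
  calc ∑ n ∈ Icc 1 x, ‖f n‖ ^ 2 ≤ ∑ n ∈ Icc 1 x, C ^ 2 :=
        Finset.sum_le_sum fun n _ => pow_le_pow_left₀ (norm_nonneg _) (hf n) 2
    _ = C ^ 2 * x := by simp [mul_comm]

lemma abs_mean_le_sqrt (u : ℕ → ℝ) (x : ℕ) :
    |(∑ n ∈ Icc 1 x, u n) / x| ≤ √((∑ n ∈ Icc 1 x, u n ^ 2) / x) := by
  refine Real.abs_le_sqrt ?_
  rcases Nat.eq_zero_or_pos x with rfl | hx
  · simp
  have hx' : (0 : ℝ) < x := by positivity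
  have := sq_sum_le_card_mul_sum_sq (s := Icc 1 x) (f := u)
  rw [Nat.card_Icc, Nat.add_sub_cancel] at this
  rw [div_pow, div_le_div_iff₀ (by positivity) hx']
  nlinarith

lemma Distributed.of_b2AlmostPeriodic {N : Set ℕ} (h : B2AlmostPeriodic (charFun N)) :
    Distributed N := by
  obtain ⟨fq, hper, hlim⟩ := h
  intro q hq a
  suffices hc : CauchySeq (fun x : ℕ =>
      (((Icc 1 x).filter (fun n => n ∈ N ∧ n % q = a % q)).card : ℝ) / x) by
    exact cauchySeq_tendsto_of_complete hc
  rw [Metric.cauchySeq_iff']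
  intro ε hε
  obtain ⟨k, hk⟩ := (hlim.eventually (gt_mem_nhds (show 0 < (ε / 4) ^ 2 by positivity))).exists
  obtain ⟨p, hp, hg⟩ := hper k
  set g := fq k
  obtain ⟨C, hC⟩ := exists_bound_of_periodic hp hg
  have hbd : ∀ n, ‖charFun N n - g n‖ ≤ 1 + C := fun n => by
    refine (norm_sub_le _ _).trans (add_le_add ?_ (hC n))
    rw [_root_.charFun]
    split_ifs <;> simp
  have hev := eventually_mean_sq_lt hbd hk
  have hw : Function.Periodic (fun n => if n % q = a % q then (g n).re else 0) (p * q) := by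
    intro n
    have : g (n + p * q) = g n := by
      rw [mul_comm]
      exact Function.Periodic.nat_mul hg q n
    simp [this]
  have hmean := tendsto_mean_of_periodic_univ (Nat.mul_pos hp hq) hw
  obtain ⟨X, hX⟩ := eventually_atTop.mp
    (hev.and (hmean.eventually (Metric.ball_mem_nhds _ (show 0 < ε / 4 by positivity))))
  have hdist : ∀ x : ℕ, X ≤ x → |(((Icc 1 x).filter (fun n => n ∈ N ∧ n % q = a % q)).card : ℝ) / x -
      (x : ℝ)⁻¹ • ∑ n ∈ Icc 1 x, (if n % q = a % q then (g n).re else 0)| < ε / 4 := by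
    intro x hx
    have heq : (((Icc 1 x).filter (fun n => n ∈ N ∧ n % q = a % q)).card : ℝ) / x -
        (x : ℝ)⁻¹ • ∑ n ∈ Icc 1 x, (if n % q = a % q then (g n).re else 0) =
        (∑ n ∈ Icc 1 x, (if n % q = a % q then (charFun N n - g n).re else 0)) / x := by
      rw [smul_eq_mul, ← div_eq_inv_mul, ← sub_div, Finset.card_filter]
      push_cast
      rw [← Finset.sum_sub_distrib]
      congr 1
      refine Finset.sum_congr rfl fun n _ => ?_
      by_cases h1 : n ∈ N <;> by_cases h2 : n % q = a % q <;> simp [_root_.charFun, h1, h2]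
    rw [heq]
    refine (abs_mean_le_sqrt _ _).trans_lt ?_
    rw [Real.sqrt_lt' (by positivity)]
    refine lt_of_le_of_lt ?_ (hX x hx).1
    refine div_le_div_of_nonneg_right (Finset.sum_le_sum fun n _ => ?_) (by positivity)
    split_ifs
    · rw [← sq_abs]
      exact pow_le_pow_left₀ (abs_nonneg _) (Complex.abs_re_le_norm _) 2
    · simp
  refine ⟨X, fun x hx => ?_⟩
  have h1 := abs_lt.mp (hdist x hx)
  have h2 := abs_lt.mp (hdist X le_rfl)
  have h3 := (hX x hx).2
  have h4 := (hX X le_rfl).2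
  rw [Real.dist_eq, abs_lt] at h3 h4
  rw [Real.dist_eq, abs_lt]
  constructor <;> linarith

lemma b2AlmostPeriodic_iff {N : Set ℕ} {ρ : ℝ} {F : ℕ → ℕ → ℝ} (hρ : HasDensity N ρ)
    (hF : ∀ q, 1 ≤ q → ∀ a, HasResidueDensity N q a (F q a)) :
    B2AlmostPeriodic (charFun N) ↔ ∀ ε > 0, ∃ Q, 1 ≤ Q ∧ ρ - residueEnergy F Q < ε := by
  constructor
  · rintro ⟨fq, hper, hlim⟩ ε hε
    obtain ⟨k, hk⟩ := (hlim.eventually (gt_mem_nhds hε)).exists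
    obtain ⟨p, hp, hg⟩ := hper k
    exact ⟨p, hp, (sub_residueEnergy_le_limsup hρ hF hp hg).trans_lt hk⟩
  · intro h
    choose Q hQ hlt using fun k : ℕ => h (1 / ((k : ℝ) + 1)) (by positivity)
    refine ⟨fun k n => ((Q k * F (Q k) n : ℝ) : ℂ), fun k => ⟨Q k, hQ k, fun n => ?_⟩, ?_⟩
    · simp only [residueDensity_periodic (hF _ (hQ k)) n]
    · have heq : ∀ k, limsup (fun x : ℕ => (∑ n ∈ Icc 1 x,
          ‖charFun N n - ((Q k * F (Q k) n : ℝ) : ℂ)‖ ^ 2) / x) atTop =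
          ρ - residueEnergy F (Q k) :=
        fun k => (tendsto_mean_sq_sub_profile hρ hF (hQ k)).limsup_eq
      simp only [heq]
      refine squeeze_zero (fun k => ?_) (fun k => (hlt k).le)
        tendsto_one_div_add_atTop_nhds_zero_nat
      linarith [residueEnergy_le hρ hF (hQ k)]

/-- a set of positive density is extremal iff it is `B²`-almost periodic. -/
theorem stmt_1 (N : Set ℕ) (hd : ∃ ρ : ℝ, 0 < ρ ∧ HasDensity N ρ) :
    Extremal N ↔ B2AlmostPeriodic (charFun N) := by
  have key : ∀ {ρ : ℝ} {F : ℕ → ℕ → ℝ}, 0 < ρ → HasDensity N ρ →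
      (∀ q, 1 ≤ q → ∀ a, HasResidueDensity N q a (F q a)) →
      (1 / ρ = extremalSum F ρ ↔ B2AlmostPeriodic (charFun N)) := by
    intro ρ F hpos hρ hF
    rw [b2AlmostPeriodic_iff hρ hF, ← tsum_primitiveEnergy_eq_iff hρ hF, extremalSum_eq,
      div_eq_div_iff hpos.ne' (by positivity), one_mul, sq, mul_left_inj' hpos.ne', eq_comm]
  constructor
  · rintro ⟨ρ, hpos, hρ, F, hF, h⟩
    exact (key hpos hρ hF).mp h
  · intro h
    obtain ⟨ρ, hpos, hρ⟩ := hd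
    have hdist := Distributed.of_b2AlmostPeriodic h
    choose! F hF using hdist
    exact ⟨ρ, hpos, hρ, F, hF, (key hpos hρ hF).mpr h⟩
end

section
/- Let r(n) denote the number of pairs of positive integers (a,b) with n = ⌊√2·a⌋ + ⌊√3·b⌋. Then r(n) ∼ n/√6 as n → ∞. -/
open MeasureTheory Filter Finset
open scoped Classical

/-- A closed subgroup containing nonzero vectors tending to `0` contains a line. -/
theorem AddSubgroup.exists_line_of_tendsto_zero {E : Type*} [NormedAddCommGroup E]
    [NormedSpace ℝ E] [ProperSpace E] (H : AddSubgroup E) (hH : IsClosed (H : Set E))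
    (w : ℕ → E) (hw : ∀ i, w i ∈ H) (hw0 : ∀ i, w i ≠ 0) (hlim : Tendsto w atTop (nhds 0)) :
    ∃ v : E, v ≠ 0 ∧ ∀ t : ℝ, t • v ∈ H := by
  have hsph : ∀ i, ‖w i‖⁻¹ • w i ∈ Metric.sphere (0 : E) 1 := fun i => by
    simp [norm_smul, inv_mul_cancel₀ (norm_ne_zero_iff.2 (hw0 i))]
  obtain ⟨v, hv, φ, hφ, hconv⟩ := (isCompact_sphere (0 : E) 1).tendsto_subseq hsph
  refine ⟨v, fun h => by simp [h] at hv, fun t => ?_⟩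
  have hwφ : Tendsto (fun i => w (φ i)) atTop (nhds 0) := hlim.comp hφ.tendsto_atTop
  have hdiff : Tendsto (fun i => ((⌊t / ‖w (φ i)‖⌋ : ℤ) : ℝ) • w (φ i) -
      (t / ‖w (φ i)‖) • w (φ i)) atTop (nhds 0) := by
    refine squeeze_zero_norm (fun i => ?_) (tendsto_zero_iff_norm_tendsto_zero.1 hwφ)
    rw [← sub_smul, norm_smul]
    refine mul_le_of_le_one_left (norm_nonneg _) ?_
    rw [Real.norm_eq_abs, abs_le]
    constructor <;> linarith [Int.floor_le (t / ‖w (φ i)‖), Int.lt_floor_add_one (t / ‖w (φ i)‖)]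
  have hlimv : Tendsto (fun i => ((⌊t / ‖w (φ i)‖⌋ : ℤ) : ℝ) • w (φ i)) atTop (nhds (t • v)) := by
    have h := hdiff.add (hconv.const_smul t)
    simp only [zero_add] at h
    refine h.congr fun i => ?_
    simp [smul_smul, div_eq_mul_inv]
  refine hH.mem_of_tendsto hlimv (Eventually.of_forall fun i => ?_)
  rw [Int.cast_smul_eq_zsmul]
  exact H.zsmul_mem (hw _) _

/-- A closed subgroup of the plane which contains the line spanned by `v` and whose image under
the linear form with kernel spanned by `v` is dense is everything. -/
theorem AddSubgroup.mem_of_line_of_dense (H : AddSubgroup (ℝ × ℝ))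
    (hH : IsClosed (H : Set (ℝ × ℝ))) (v : ℝ × ℝ) (hv : v ≠ 0) (hline : ∀ t : ℝ, t • v ∈ H)
    (hdense : Dense {y : ℝ | ∃ p ∈ H, v.2 * p.1 - v.1 * p.2 = y}) (x : ℝ × ℝ) : x ∈ H := by
  obtain ⟨v₁, v₂⟩ := v
  have hq : v₁ ^ 2 + v₂ ^ 2 ≠ 0 := by
    intro h
    apply hv
    have h1 : v₁ = 0 := by nlinarith [sq_nonneg v₁, sq_nonneg v₂]
    have h2 : v₂ = 0 := by nlinarith [sq_nonneg v₁, sq_nonneg v₂]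
    simp [h1, h2]
  have hclosed : IsClosed {y : ℝ | (y / (v₁ ^ 2 + v₂ ^ 2) * v₂, -(y / (v₁ ^ 2 + v₂ ^ 2) * v₁)) ∈ H} :=
    hH.preimage (f := fun y : ℝ =>
      (y / (v₁ ^ 2 + v₂ ^ 2) * v₂, -(y / (v₁ ^ 2 + v₂ ^ 2) * v₁))) (by fun_prop)
  have hsub : {y : ℝ | ∃ p ∈ H, v₂ * p.1 - v₁ * p.2 = y} ⊆
      {y : ℝ | (y / (v₁ ^ 2 + v₂ ^ 2) * v₂, -(y / (v₁ ^ 2 + v₂ ^ 2) * v₁)) ∈ H} := by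
    rintro y ⟨p, hp, rfl⟩
    have := H.sub_mem hp (hline ((p.1 * v₁ + p.2 * v₂) / (v₁ ^ 2 + v₂ ^ 2)))
    rw [Set.mem_ofPred_eq]
    convert this using 1
    ext <;> simp <;> field_simp <;> ring
  have huniv := hclosed.closure_subset_iff.2 hsub
  rw [hdense.closure_eq] at huniv
  have hx := huniv (Set.mem_univ (v₂ * x.1 - v₁ * x.2))
  have := H.add_mem hx (hline ((x.1 * v₁ + x.2 * v₂) / (v₁ ^ 2 + v₂ ^ 2)))
  convert this using 1
  ext <;> simp <;> field_simp <;> ring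

/-- A two-dimensional case of Kronecker's approximation theorem. -/
theorem exists_int_simultaneous_approx {α β : ℝ} (hα : 0 < α) (hβ : 0 < β)
    (hα' : Irrational α)
    (hind : ∀ l m n : ℤ, n / α - m / β = l → m = 0 ∧ n = 0) (x y : ℝ) {δ : ℝ} (hδ : 0 < δ) :
    ∃ s h k : ℤ, |s + α * h - x| < δ ∧ |s + β * k - y| < δ := by
  let L : AddSubgroup (ℝ × ℝ) :=
    { carrier := {p | ∃ s h k : ℤ, p = (s + α * h, s + β * k)}
      zero_mem' := ⟨0, 0, 0, by ext <;> simp⟩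
      add_mem' := by
        rintro _ _ ⟨s, h, k, rfl⟩ ⟨s', h', k', rfl⟩
        exact ⟨s + s', h + h', k + k', by ext <;> simp <;> ring⟩
      neg_mem' := by
        rintro _ ⟨s, h, k, rfl⟩
        exact ⟨-s, -h, -k, by ext <;> simp <;> ring⟩ }
  have hLmem : ∀ s h k : ℤ, ((s + α * h, s + β * k) : ℝ × ℝ) ∈ L := fun s h k => ⟨s, h, k, rfl⟩
  let H := L.topologicalClosure
  have hLH : L ≤ H := L.le_topologicalClosure
  have hH : IsClosed (H : Set (ℝ × ℝ)) := L.isClosed_topologicalClosure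
  let u : ℕ → ℝ × ℝ := fun s => ((s : ℤ) + α * (-⌊s / α⌋ : ℤ), (s : ℤ) + β * (-⌊s / β⌋ : ℤ))
  have hbound : ∀ {γ : ℝ}, 0 < γ → ∀ s : ℕ,
      ((s : ℤ) : ℝ) + γ * (-⌊s / γ⌋ : ℤ) ∈ Set.Icc 0 γ := by
    intro γ hγ s
    have h1 := Int.floor_le (s / γ)
    have h2 := Int.lt_floor_add_one (s / γ)
    rw [le_div_iff₀ hγ] at h1
    rw [div_lt_iff₀ hγ] at h2
    push_cast
    constructor <;> nlinarith
  have huinj : Function.Injective u := by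
    intro s t hst
    have h1 : ((s : ℤ) : ℝ) + α * (-⌊s / α⌋ : ℤ) = (t : ℤ) + α * (-⌊t / α⌋ : ℤ) :=
      congrArg Prod.fst hst
    have h2 : α * ((⌊s / α⌋ - ⌊t / α⌋ : ℤ) : ℝ) = ((s - t : ℤ) : ℝ) := by
      push_cast at h1 ⊢; linarith
    by_cases h0 : ⌊s / α⌋ - ⌊t / α⌋ = 0
    · rw [h0] at h2
      have : ((s - t : ℤ) : ℝ) = 0 := by rw [← h2]; simp
      have := Int.cast_eq_zero.1 this
      omega
    · exact absurd h2 ((hα'.mul_intCast h0).ne_int _)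
  obtain ⟨z, -, φ, hφ, hconv⟩ := (isCompact_Icc.prod isCompact_Icc).tendsto_subseq
    (fun s => (⟨hbound hα s, hbound hβ s⟩ : u s ∈ Set.Icc 0 α ×ˢ Set.Icc 0 β))
  obtain ⟨v, hv, hline⟩ := H.exists_line_of_tendsto_zero hH
    (fun i => u (φ (i + 1)) - u (φ i))
    (fun i => H.sub_mem (hLH (hLmem _ _ _)) (hLH (hLmem _ _ _)))
    (fun i => sub_ne_zero.2 fun h => by
      have := hφ.injective (huinj h); omega)
    (by simpa using (hconv.comp (tendsto_add_atTop_nat 1)).sub hconv)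
  have hdense : Dense {y : ℝ | ∃ p ∈ H, v.2 * p.1 - v.1 * p.2 = y} := by
    let f : ℝ × ℝ →+ ℝ :=
      { toFun := fun p => v.2 * p.1 - v.1 * p.2
        map_zero' := by simp
        map_add' := fun p q => by simp; ring }
    rcases (H.map f).dense_or_cyclic with h | ⟨c, hc⟩
    · exact h
    · exfalso
      have hmem : ∀ s h k : ℤ, ∃ m : ℤ, (m : ℝ) * c = v.2 * (s + α * h) - v.1 * (s + β * k) := by
        intro s h k
        have h1 : f (s + α * h, s + β * k) ∈ H.map f :=
          AddSubgroup.mem_map_of_mem f (hLH (hLmem s h k))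
        rw [hc, AddSubgroup.mem_closure_singleton] at h1
        obtain ⟨m, hm⟩ := h1
        exact ⟨m, by simpa [f] using hm⟩
      obtain ⟨n, hn⟩ := hmem 0 1 0
      obtain ⟨m, hm⟩ := hmem 0 0 (-1)
      obtain ⟨l, hl⟩ := hmem 1 0 0
      simp only [Int.cast_zero, Int.cast_one, Int.cast_neg, mul_zero, mul_one, zero_add,
        add_zero, sub_zero, zero_sub] at hn hm hl
      have hmn : (m : ℝ) = 0 ∧ (n : ℝ) = 0 → False := by
        rintro ⟨h1, h2⟩
        rw [h2] at hn
        rw [h1] at hm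
        have hv2 : v.2 = 0 := by
          rcases mul_eq_zero.1 (show v.2 * α = 0 by linarith) with h | h
          · exact h
          · exact absurd h hα.ne'
        have hv1 : v.1 = 0 := by
          rcases mul_eq_zero.1 (show v.1 * β = 0 by linarith) with h | h
          · exact h
          · exact absurd h hβ.ne'
        exact hv (Prod.ext hv1 hv2)
      have hc0 : c ≠ 0 := by
        rintro rfl
        have hv2 : v.2 = 0 := by
          rcases mul_eq_zero.1 (show v.2 * α = 0 by linarith) with h | h
          · exact h
          · exact absurd h hα.ne'
        have hv1 : v.1 = 0 := by linarith
        exact hv (Prod.ext hv1 hv2)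
      obtain ⟨h1, h2⟩ := hind l m n (by
        apply mul_right_cancel₀ hc0
        rw [hl, sub_mul, div_mul_eq_mul_div, div_mul_eq_mul_div, hn, hm]
        field_simp)
      exact hmn ⟨by simp [h1], by simp [h2]⟩
  have hxy : (x, y) ∈ closure (L : Set (ℝ × ℝ)) :=
    H.mem_of_line_of_dense hH v hv hline hdense (x, y)
  obtain ⟨_, ⟨s, h, k, rfl⟩, hdist⟩ := Metric.mem_closure_iff.1 hxy δ hδ
  rw [dist_comm, Prod.dist_eq, max_lt_iff, Real.dist_eq, Real.dist_eq] at hdist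
  exact ⟨s, h, k, hdist⟩

theorem Irrational.exists_forall_lt_abs_sub {α : ℝ} (hα : Irrational α) (M : ℕ) :
    ∃ δ : ℝ, 0 < δ ∧ ∀ j : ℤ, 0 < j → j ≤ M → ∀ z : ℤ, δ < |α * j - z| := by
  induction M with
  | zero => exact ⟨1, one_pos, fun j h1 h2 => by simp at h2; omega⟩
  | succ M ih =>
    obtain ⟨δ, hδ, h⟩ := ih
    set y := α * ((M + 1 : ℤ) : ℝ) with hy
    have hpos : 0 < |y - round y| :=
      abs_pos.2 (sub_ne_zero.2 ((hα.mul_intCast (by omega)).ne_int _))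
    refine ⟨min δ (|y - round y| / 2), by positivity, fun j h1 h2 z => ?_⟩
    rcases eq_or_ne j (M + 1) with rfl | hne
    · rw [← hy]
      linarith [min_le_right δ (|y - round y| / 2), round_le y z]
    · exact (min_le_left _ _).trans_lt (h j h1 (by push_cast at h2; omega) z)

/-- The positive integers `a ≤ n` such that `α * a` is within `δ` of an integer or `a ≤ c`. -/
def nearIntegers (α δ : ℝ) (c n : ℤ) : Set ℤ :=
  {a | 0 < a ∧ a ≤ n ∧ ((∃ z : ℤ, |α * a - z| ≤ δ) ∨ a ≤ c)}

theorem nearIntegers_finite (α δ : ℝ) (c n : ℤ) : (nearIntegers α δ c n).Finite :=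
  (Set.finite_Icc 1 n).subset fun _ ha => ⟨ha.1, ha.2.1⟩

theorem exists_ncard_nearIntegers_le {α : ℝ} (hα : Irrational α) {ε : ℝ} (hε : 0 < ε) :
    ∃ δ : ℝ, 0 < δ ∧ ∀ c n : ℤ, 0 ≤ c → 0 ≤ n →
      ((nearIntegers α δ c n).ncard : ℝ) ≤ ε * n + 1 + c := by
  obtain ⟨M, hM⟩ := exists_nat_one_div_lt hε
  obtain ⟨δ, hδ, hgap⟩ := hα.exists_forall_lt_abs_sub (M + 1)
  refine ⟨δ / 2, by positivity, fun c n hc hn => ?_⟩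
  have hsub : nearIntegers α (δ / 2) c n ⊆
      {a : ℤ | 0 < a ∧ a ≤ n ∧ ∃ z : ℤ, |α * a - z| ≤ δ / 2} ∪ Set.Icc 1 c := by
    rintro a ⟨h1, h2, h3 | h3⟩
    · exact Or.inl ⟨h1, h2, h3⟩
    · exact Or.inr ⟨h1, h3⟩
  have hfin : {a : ℤ | 0 < a ∧ a ≤ n ∧ ∃ z : ℤ, |α * a - z| ≤ δ / 2}.Finite :=
    (Set.finite_Icc 1 n).subset fun _ ha => ⟨ha.1, ha.2.1⟩
  have hclose : ∀ a b : ℤ, (∃ z : ℤ, |α * a - z| ≤ δ / 2) → (∃ z : ℤ, |α * b - z| ≤ δ / 2) →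
      a < b → a / (M + 1 : ℤ) = b / (M + 1 : ℤ) → False := by
    rintro a b ⟨z, hz⟩ ⟨w, hw⟩ hab hdiv
    have hle : b - a ≤ (M + 1 : ℕ) := by
      have h1 := Int.emod_add_mul_ediv a (M + 1 : ℤ)
      have h2 := Int.emod_add_mul_ediv b (M + 1 : ℤ)
      have h3 := Int.emod_nonneg a (show (M + 1 : ℤ) ≠ 0 by omega)
      have h4 := Int.emod_lt_of_pos b (show (0 : ℤ) < M + 1 by omega)
      rw [hdiv] at h1
      push_cast
      linarith
    have h := hgap (b - a) (by omega) hle (w - z)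
    have h' := abs_sub (α * b - w) (α * a - z)
    rw [show α * ((b - a : ℤ) : ℝ) - ((w - z : ℤ) : ℝ) = (α * b - w) - (α * a - z) by
      push_cast; ring] at h
    linarith
  have hcard : {a : ℤ | 0 < a ∧ a ≤ n ∧ ∃ z : ℤ, |α * a - z| ≤ δ / 2}.ncard ≤
      (Set.Icc (0 : ℤ) (n / (M + 1 : ℤ))).ncard := by
    refine Set.ncard_le_ncard_of_injOn (fun a => a / (M + 1 : ℤ)) ?_ ?_ (Set.finite_Icc _ _)
    · rintro a ⟨h1, h2, -⟩
      exact ⟨Int.ediv_nonneg h1.le (by omega), Int.ediv_le_ediv (by omega) h2⟩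
    · rintro a ⟨-, -, ha⟩ b ⟨-, -, hb⟩ hab
      rcases lt_trichotomy a b with h | h | h
      · exact (hclose a b ha hb h hab).elim
      · exact h
      · exact (hclose b a hb ha h hab.symm).elim
  have hicc : ∀ x y : ℤ, (Set.Icc x y).ncard = (y + 1 - x).toNat := fun x y => by
    rw [← Finset.coe_Icc, Set.ncard_coe_finset, Int.card_Icc]
  have htotal : (nearIntegers α (δ / 2) c n).ncard ≤ (n / (M + 1 : ℤ) + 1).toNat + c.toNat := by
    refine (Set.ncard_le_ncard hsub (hfin.union (Set.finite_Icc _ _))).trans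
      ((Set.ncard_union_le _ _).trans ?_)
    refine (Nat.add_le_add_right hcard _).trans ?_
    rw [hicc, hicc]
    simp
  have hq : 0 ≤ n / (M + 1 : ℤ) := Int.ediv_nonneg hn (by omega)
  have hZ : ((nearIntegers α (δ / 2) c n).ncard : ℤ) ≤ n / (M + 1 : ℤ) + 1 + c := by omega
  have hR : ((nearIntegers α (δ / 2) c n).ncard : ℝ) ≤ ((n / (M + 1 : ℤ) : ℤ) : ℝ) + 1 + c := by
    exact_mod_cast hZ
  have hdiv : ((n / (M + 1 : ℤ) : ℤ) : ℝ) ≤ ε * n := by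
    have h1 : ((n / (M + 1 : ℤ) : ℤ) : ℝ) * (M + 1) ≤ n := by
      exact_mod_cast Int.ediv_mul_le n (show (M + 1 : ℤ) ≠ 0 by omega)
    have h2 : (1 : ℝ) < ε * (M + 1) := by
      rwa [div_lt_iff₀ (by positivity)] at hM
    have h3 : (0 : ℝ) ≤ ((n / (M + 1 : ℤ) : ℤ) : ℝ) := by exact_mod_cast hq
    have h4 : (0 : ℝ) ≤ n := by exact_mod_cast hn
    nlinarith [mul_le_mul_of_nonneg_left h1 hε.le]
  linarith

/-- The pairs of positive integers `(a, b)` with `⌊α * a⌋ + ⌊β * b⌋ = n`. -/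
def beattyPairs (α β : ℝ) (n : ℤ) : Set (ℤ × ℤ) :=
  {p | 0 < p.1 ∧ 0 < p.2 ∧ ⌊α * p.1⌋ + ⌊β * p.2⌋ = n}

theorem le_floor_mul_of_one_le {α : ℝ} (hα : 1 ≤ α) {a : ℤ} (ha : 0 < a) : a ≤ ⌊α * a⌋ := by
  have : (0 : ℝ) < a := by exact_mod_cast ha
  exact Int.le_floor.2 (by nlinarith)

theorem floor_mul_injective_of_one_le {α : ℝ} (hα : 1 ≤ α) :
    Function.Injective fun a : ℤ => ⌊α * a⌋ := by
  have : StrictMono fun a : ℤ => ⌊α * a⌋ := strictMono_int_of_lt_succ fun a => by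
    rw [← Int.add_one_le_iff, Int.le_floor]
    push_cast
    linarith [Int.floor_le (α * a)]
  exact this.injective

theorem floor_mul_add_eq {α δ : ℝ} {a h s : ℤ} (hs : |α * h - s| ≤ δ)
    (ha : ∀ z : ℤ, δ < |α * a - z|) : ⌊α * ((a + h : ℤ) : ℝ)⌋ = ⌊α * a⌋ + s := by
  have h1 := ha ⌊α * a⌋
  have h2 := ha (⌊α * a⌋ + 1)
  rw [abs_of_nonneg (by linarith [Int.floor_le (α * a)])] at h1
  rw [abs_of_nonpos (by push_cast; linarith [Int.lt_floor_add_one (α * a)])] at h2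
  rw [abs_le] at hs
  rw [Int.floor_eq_iff]
  push_cast at h2 ⊢
  constructor <;> linarith

theorem beattyPairs_le {α β : ℝ} (hα : 1 ≤ α) (hβ : 1 ≤ β) {n : ℤ} {p : ℤ × ℤ}
    (hp : p ∈ beattyPairs α β n) : p.1 ≤ n ∧ p.2 ≤ n := by
  obtain ⟨h1, h2, h3⟩ := hp
  have h4 := le_floor_mul_of_one_le hα h1
  have h5 := le_floor_mul_of_one_le hβ h2
  omega

theorem beattyPairs_finite {α β : ℝ} (hα : 1 ≤ α) (hβ : 1 ≤ β) (n : ℤ) :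
    (beattyPairs α β n).Finite :=
  ((Set.finite_Icc 1 n).prod (Set.finite_Icc 1 n)).subset fun _ hp =>
    ⟨⟨hp.1, (beattyPairs_le hα hβ hp).1⟩, ⟨hp.2.1, (beattyPairs_le hα hβ hp).2⟩⟩

/-- The number of pairs is almost invariant under a shift `n ↦ n + d` approximated by multiples
of `α` and `β`. -/
theorem exists_ncard_beattyPairs_le_add {α β : ℝ} (hα : 1 ≤ α) (hβ : 1 ≤ β)
    (hα' : Irrational α) (hβ' : Irrational β) (d : ℤ)
    (happrox : ∀ δ : ℝ, 0 < δ → ∃ s h k : ℤ, |α * h - s| ≤ δ ∧ |β * k - (d - s : ℤ)| ≤ δ)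
    {ε : ℝ} (hε : 0 < ε) :
    ∃ C : ℝ, ∀ n : ℤ, 0 ≤ n → ((beattyPairs α β n).ncard : ℝ) ≤
      (beattyPairs α β (n + d)).ncard + ε * n + C := by
  obtain ⟨δ₁, hδ₁, hc₁⟩ := exists_ncard_nearIntegers_le hα' (half_pos hε)
  obtain ⟨δ₂, hδ₂, hc₂⟩ := exists_ncard_nearIntegers_le hβ' (half_pos hε)
  obtain ⟨s, h, k, hs, hk⟩ := happrox (min δ₁ δ₂) (lt_min hδ₁ hδ₂)
  replace hs := hs.trans (min_le_left _ _)
  replace hk := hk.trans (min_le_right _ _)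
  refine ⟨2 + |h| + |k|, fun n hn => ?_⟩
  have hfin := beattyPairs_finite hα hβ n
  set A := beattyPairs α β n with hA
  set B₁ := {p ∈ A | p.1 ∈ nearIntegers α δ₁ |h| n}
  set B₂ := {p ∈ A | p.2 ∈ nearIntegers β δ₂ |k| n}
  have hB₁ : B₁.ncard ≤ (nearIntegers α δ₁ |h| n).ncard := by
    refine Set.ncard_le_ncard_of_injOn Prod.fst (fun p hp => hp.2) ?_ (nearIntegers_finite _ _ _ _)
    rintro ⟨a, b⟩ ⟨⟨-, -, h1⟩, -⟩ ⟨a', b'⟩ ⟨⟨-, -, h2⟩, -⟩ (rfl : a = a')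
    have : b = b' := floor_mul_injective_of_one_le hβ (by simp only at h1 h2 ⊢; omega)
    rw [this]
  have hB₂ : B₂.ncard ≤ (nearIntegers β δ₂ |k| n).ncard := by
    refine Set.ncard_le_ncard_of_injOn Prod.snd (fun p hp => hp.2) ?_ (nearIntegers_finite _ _ _ _)
    rintro ⟨a, b⟩ ⟨⟨-, -, h1⟩, -⟩ ⟨a', b'⟩ ⟨⟨-, -, h2⟩, -⟩ (rfl : b = b')
    have : a = a' := floor_mul_injective_of_one_le hα (by simp only at h1 h2 ⊢; omega)
    rw [this]
  have hG : (A \ (B₁ ∪ B₂)).ncard ≤ (beattyPairs α β (n + d)).ncard := by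
    refine Set.ncard_le_ncard_of_injOn (fun p => (p.1 + h, p.2 + k)) ?_ ?_
      (beattyPairs_finite hα hβ _)
    · rintro ⟨a, b⟩ ⟨hp, hnot⟩
      have hle := beattyPairs_le hα hβ hp
      have h1 : ¬ ((∃ z : ℤ, |α * a - z| ≤ δ₁) ∨ a ≤ |h|) := fun hbad =>
        hnot (Or.inl ⟨hp, hp.1, hle.1, hbad⟩)
      have h2 : ¬ ((∃ z : ℤ, |β * b - z| ≤ δ₂) ∨ b ≤ |k|) := fun hbad =>
        hnot (Or.inr ⟨hp, hp.2.1, hle.2, hbad⟩)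
      push Not at h1 h2
      refine ⟨?_, ?_, ?_⟩
      · change 0 < a + h
        linarith [neg_abs_le h, h1.2]
      · change 0 < b + k
        linarith [neg_abs_le k, h2.2]
      · have h3 : ⌊α * a⌋ + ⌊β * b⌋ = n := hp.2.2
        simp only
        rw [floor_mul_add_eq hs h1.1, floor_mul_add_eq hk h2.1]
        omega
    · rintro ⟨a, b⟩ - ⟨a', b'⟩ - hab
      simpa using hab
  have hsub : A ⊆ (A \ (B₁ ∪ B₂)) ∪ (B₁ ∪ B₂) := by
    rw [Set.sdiff_union_self]
    exact Set.subset_union_left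
  have hBfin : (B₁ ∪ B₂).Finite := hfin.subset (by rintro p (hp | hp) <;> exact hp.1)
  have htot : A.ncard ≤ (beattyPairs α β (n + d)).ncard + ((nearIntegers α δ₁ |h| n).ncard +
      (nearIntegers β δ₂ |k| n).ncard) :=
    (Set.ncard_le_ncard hsub (hfin.sdiff.union hBfin)).trans <| (Set.ncard_union_le _ _).trans <|
      add_le_add hG ((Set.ncard_union_le _ _).trans (add_le_add hB₁ hB₂))
  have htotR : (A.ncard : ℝ) ≤ (beattyPairs α β (n + d)).ncard +
      ((nearIntegers α δ₁ |h| n).ncard + (nearIntegers β δ₂ |k| n).ncard) := by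
    exact_mod_cast htot
  have e1 := hc₁ |h| n (abs_nonneg _) hn
  have e2 := hc₂ |k| n (abs_nonneg _) hn
  push_cast at e1 e2 ⊢
  linarith

theorem Int.card_Ico_ceil_le {x y : ℝ} (hxy : x ≤ y) :
    ((Finset.Ico ⌈x⌉ ⌈y⌉).card : ℝ) ≤ y - x + 1 := by
  have h : (((Finset.Ico ⌈x⌉ ⌈y⌉).card : ℤ) : ℝ) = ((⌈y⌉ - ⌈x⌉ : ℤ) : ℝ) := by
    rw [Int.card_Ico_of_le _ _ (Int.ceil_mono hxy)]
  push_cast at h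
  linarith [Int.ceil_lt_add_one y, Int.le_ceil x]

theorem Int.le_card_Ico_ceil {x y : ℝ} (hxy : x ≤ y) :
    y - x - 1 ≤ ((Finset.Ico ⌈x⌉ ⌈y⌉).card : ℝ) := by
  have h : (((Finset.Ico ⌈x⌉ ⌈y⌉).card : ℤ) : ℝ) = ((⌈y⌉ - ⌈x⌉ : ℤ) : ℝ) := by
    rw [Int.card_Ico_of_le _ _ (Int.ceil_mono hxy)]
  push_cast at h
  linarith [Int.ceil_lt_add_one x, Int.le_ceil y]

theorem Int.mem_Ico_ceil_div_iff {β : ℝ} (hβ : 0 < β) {b m l : ℤ} :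
    b ∈ Finset.Ico ⌈(m : ℝ) / β⌉ ⌈(l : ℝ) / β⌉ ↔ m ≤ ⌊β * b⌋ ∧ ⌊β * b⌋ < l := by
  rw [Finset.mem_Ico, Int.ceil_le, Int.lt_ceil, div_le_iff₀ hβ, lt_div_iff₀ hβ, Int.le_floor,
    Int.floor_lt, mul_comm β]

theorem sum_ncard_beattyPairs {α β : ℝ} (hα : 1 ≤ α) (hβ : 1 ≤ β) (n : ℤ) (K : ℕ) :
    ∑ j ∈ Finset.range K, (beattyPairs α β (n + j)).ncard =
      ∑ a ∈ Finset.Icc 1 (n + K), ((Finset.Icc 1 (n + K)).filter fun b : ℤ =>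
        n - ⌊α * a⌋ ≤ ⌊β * b⌋ ∧ ⌊β * b⌋ < n - ⌊α * a⌋ + K).card := by
  set W := ((Finset.Icc 1 (n + K)) ×ˢ (Finset.Icc 1 (n + K))).filter fun p : ℤ × ℤ =>
    n - ⌊α * p.1⌋ ≤ ⌊β * p.2⌋ ∧ ⌊β * p.2⌋ < n - ⌊α * p.1⌋ + K with hW
  have h1 : W.card = ∑ j ∈ Finset.range K, (beattyPairs α β (n + j)).ncard := by
    rw [Finset.card_eq_sum_card_fiberwise (f := fun p : ℤ × ℤ => (⌊α * p.1⌋ + ⌊β * p.2⌋ - n).toNat)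
      (t := Finset.range K)]
    · refine Finset.sum_congr rfl fun j hj => ?_
      rw [Finset.mem_range] at hj
      rw [← Set.ncard_coe_finset]
      congr 1
      ext p
      simp only [hW, Finset.coe_filter, Finset.mem_filter, Finset.mem_product, Finset.mem_Icc,
        Set.mem_ofPred_eq]
      constructor
      · rintro ⟨⟨⟨⟨h1, -⟩, h2, -⟩, h3, h4⟩, h5⟩
        exact ⟨by omega, by omega, by omega⟩
      · intro hp
        have hle := beattyPairs_le hα hβ hp
        obtain ⟨h1, h2, h3⟩ := hp
        omega
    · intro p hp
      simp only [hW, Finset.coe_filter, Finset.mem_product, Finset.mem_Icc,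
        Set.mem_ofPred_eq] at hp
      simp only [Finset.coe_range, Set.mem_Iio]
      omega
  rw [← h1, hW, Finset.card_filter, Finset.sum_product]
  simp only [Finset.card_filter]

theorem sum_ncard_beattyPairs_le {α β : ℝ} (hα : 1 ≤ α) (hβ : 1 ≤ β) {n : ℤ} (hn : 0 ≤ n)
    (K : ℕ) : ∑ j ∈ Finset.range K, ((beattyPairs α β (n + j)).ncard : ℝ) ≤
      (n + K) / α * (K / β + 1) := by
  have hα0 : 0 < α := by linarith
  have hβ0 : 0 < β := by linarith
  have hnR : (0 : ℝ) ≤ n := by exact_mod_cast hn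
  rw [← Nat.cast_sum, sum_ncard_beattyPairs hα hβ, Nat.cast_sum]
  rw [← Finset.sum_subset (s₁ := Finset.Icc 1 ⌊(n + K) / α⌋)]
  · refine (Finset.sum_le_card_nsmul _ _ (K / β + 1) fun a _ => ?_).trans ?_
    · have hsub : ((Finset.Icc 1 (n + K)).filter fun b : ℤ =>
          n - ⌊α * a⌋ ≤ ⌊β * b⌋ ∧ ⌊β * b⌋ < n - ⌊α * a⌋ + K) ⊆
          Finset.Ico ⌈((n - ⌊α * a⌋ : ℤ) : ℝ) / β⌉ ⌈((n - ⌊α * a⌋ + K : ℤ) : ℝ) / β⌉ := fun b hb =>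
        (Int.mem_Ico_ceil_div_iff hβ0).2 (Finset.mem_filter.1 hb).2
      refine (Nat.cast_le.2 (Finset.card_le_card hsub)).trans
        ((Int.card_Ico_ceil_le ?_).trans (le_of_eq ?_))
      · gcongr
        omega
      · push_cast
        ring
    · rw [nsmul_eq_mul, Int.card_Icc]
      have h0 : (0 : ℝ) ≤ (n + K) / α := by positivity
      have h1 : (((⌊((n : ℝ) + K) / α⌋ + 1 - 1).toNat : ℤ) : ℝ) = (⌊((n : ℝ) + K) / α⌋ : ℤ) := by
        rw [Int.toNat_of_nonneg (by have := Int.floor_nonneg.2 h0; omega), add_sub_cancel_right]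
      rw [Int.cast_natCast] at h1
      rw [h1]
      gcongr
      exact Int.floor_le _
  · refine Finset.Icc_subset_Icc le_rfl ?_
    have h0 : ((n : ℝ) + K) / α ≤ ((n + K : ℤ) : ℝ) := by
      push_cast
      exact div_le_self (by positivity) hα
    exact_mod_cast (Int.floor_le _).trans h0
  · intro a ha ha'
    rw [Finset.mem_Icc] at ha ha'
    rw [Nat.cast_eq_zero, Finset.card_eq_zero, Finset.filter_eq_empty_iff]
    intro b hb
    rw [Finset.mem_Icc] at hb
    have h1 : ((n : ℝ) + K) / α < a := Int.floor_lt.1 (by omega)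
    rw [div_lt_iff₀ hα0] at h1
    have h2 : n + K ≤ ⌊α * a⌋ := Int.le_floor.2 (by push_cast; linarith)
    have h3 := le_floor_mul_of_one_le hβ (show 0 < b by omega)
    omega

theorem le_sum_ncard_beattyPairs {α β : ℝ} (hα : 1 ≤ α) (hβ : 1 ≤ β) {n : ℤ} (hn : 0 ≤ n)
    {K : ℕ} (hK : β ≤ K) : (n / α - 1) * (K / β - 1) ≤
      ∑ j ∈ Finset.range K, ((beattyPairs α β (n + j)).ncard : ℝ) := by
  have hα0 : 0 < α := by linarith
  have hβ0 : 0 < β := by linarith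
  have hnR : (0 : ℝ) ≤ n := by exact_mod_cast hn
  have hK1 : 0 ≤ (K : ℝ) / β - 1 := by rw [sub_nonneg, one_le_div hβ0]; exact hK
  rw [← Nat.cast_sum, sum_ncard_beattyPairs hα hβ, Nat.cast_sum]
  have hceil : ⌈(n : ℝ) / α⌉ ≤ n := Int.ceil_le.2 (div_le_self hnR hα)
  have hsub : Finset.Ico 1 ⌈(n : ℝ) / α⌉ ⊆ Finset.Icc 1 (n + K) := fun a ha => by
    rw [Finset.mem_Ico] at ha
    rw [Finset.mem_Icc]
    omega
  refine le_trans ?_ (Finset.sum_le_sum_of_subset_of_nonneg hsub fun _ _ _ => by positivity)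
  refine le_trans ?_ (Finset.card_nsmul_le_sum _ _ (K / β - 1) fun a ha => ?_)
  · rw [nsmul_eq_mul]
    gcongr
    have h1 : ⌈(n : ℝ) / α⌉ ≤ ((Finset.Ico 1 ⌈(n : ℝ) / α⌉).card : ℤ) + 1 := by
      rw [Int.card_Ico]
      omega
    have h2 : ((⌈(n : ℝ) / α⌉ : ℤ) : ℝ) ≤ ((Finset.Ico 1 ⌈(n : ℝ) / α⌉).card : ℝ) + 1 := by
      exact_mod_cast h1
    linarith [Int.le_ceil ((n : ℝ) / α)]
  · rw [Finset.mem_Ico, Int.lt_ceil, lt_div_iff₀ hα0] at ha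
    have hlt : ⌊α * a⌋ < n := Int.floor_lt.2 (by linarith)
    have hfloor := le_floor_mul_of_one_le hα (show 0 < a by omega)
    have hsub : Finset.Ico ⌈((n - ⌊α * a⌋ : ℤ) : ℝ) / β⌉ ⌈((n - ⌊α * a⌋ + K : ℤ) : ℝ) / β⌉ ⊆
        ((Finset.Icc 1 (n + K)).filter fun b : ℤ =>
          n - ⌊α * a⌋ ≤ ⌊β * b⌋ ∧ ⌊β * b⌋ < n - ⌊α * a⌋ + K) := by
      intro b hb
      have hb' := (Int.mem_Ico_ceil_div_iff hβ0).1 hb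
      rw [Finset.mem_filter, Finset.mem_Icc]
      have hbpos : 0 < b := by
        by_contra! h
        have h1 : (b : ℝ) ≤ 0 := by exact_mod_cast h
        have h2 : ⌊β * b⌋ ≤ 0 := Int.floor_le_iff.2 (by push_cast; nlinarith)
        omega
      have := le_floor_mul_of_one_le hβ hbpos
      exact ⟨by omega, hb'⟩
    refine le_trans ?_ (Nat.cast_le.2 (Finset.card_le_card hsub))
    refine le_trans (le_of_eq ?_) (Int.le_card_Ico_ceil ?_)
    · push_cast
      ring
    · gcongr
      omega

theorem exists_abs_ncard_beattyPairs_sub_le {α β : ℝ} (hα : 1 ≤ α) (hβ : 1 ≤ β)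
    (hα' : Irrational α) (hβ' : Irrational β)
    (hind : ∀ l m n : ℤ, n / α - m / β = l → m = 0 ∧ n = 0) {ε : ℝ} (hε : 0 < ε) :
    ∃ C : ℝ, ∀ n : ℤ, 0 ≤ n →
      |((beattyPairs α β n).ncard : ℝ) - n / (α * β)| ≤ 2 * ε * n + C := by
  have hα0 : 0 < α := by linarith
  have hβ0 : 0 < β := by linarith
  have happrox : ∀ d : ℤ, ∀ δ : ℝ, 0 < δ →
      ∃ s h k : ℤ, |α * h - s| ≤ δ ∧ |β * k - (d - s : ℤ)| ≤ δ := by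
    intro d δ hδ
    obtain ⟨s, h, k, h1, h2⟩ := exists_int_simultaneous_approx hα0 hβ0 hα' hind 0 d hδ
    rw [abs_lt] at h1 h2
    refine ⟨s, -h, k, ?_, ?_⟩ <;> rw [abs_le] <;> push_cast <;> constructor <;> linarith
  choose C hC using fun d : ℤ => exists_ncard_beattyPairs_le_add hα hβ hα' hβ' d (happrox d) hε
  obtain ⟨K, hKε⟩ := exists_nat_ge (max β (1 / ε))
  have hKβ : β ≤ K := (le_max_left _ _).trans hKε
  have hK0 : (0 : ℝ) < K := hβ0.trans_le hKβ
  have hεK : 1 ≤ K * ε := (div_le_iff₀ hε).1 ((le_max_right _ _).trans hKε)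
  set r : ℤ → ℝ := fun n => (beattyPairs α β n).ncard with hr
  set C₁ := ∑ j ∈ Finset.range K, C j with hC₁
  set C₂ := ∑ j ∈ Finset.range K, (ε * j + C (-j)) with hC₂
  refine ⟨(|C₁ + K / α * (K / β + 1)| + |C₂ + K / β|) / K, fun n hn => ?_⟩
  have hnR : (0 : ℝ) ≤ n := by exact_mod_cast hn
  have hsum₁ : K * r n ≤ ∑ j ∈ Finset.range K, r (n + j) + K * (ε * n) + C₁ := by
    have h := Finset.sum_le_sum fun j (_ : j ∈ Finset.range K) => hC j n hn
    simpa [Finset.sum_add_distrib] using h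
  have hsum₂ : ∑ j ∈ Finset.range K, r (n + j) ≤ K * r n + K * (ε * n) + C₂ := by
    have h : ∑ j ∈ Finset.range K, r (n + j) ≤
        ∑ j ∈ Finset.range K, (r n + ε * n + (ε * j + C (-j))) :=
      Finset.sum_le_sum fun j _ => by
        have h := hC (-j) (n + j) (by omega)
        rw [add_neg_cancel_right] at h
        push_cast at h
        linarith
    simpa [Finset.sum_add_distrib, mul_add, ← hC₂] using h
  have hupper : ∑ j ∈ Finset.range K, r (n + j) ≤ (n + K) / α * (K / β + 1) :=
    sum_ncard_beattyPairs_le hα hβ hn K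
  have hlower : (n / α - 1) * (K / β - 1) ≤ ∑ j ∈ Finset.range K, r (n + j) :=
    le_sum_ncard_beattyPairs hα hβ hn hKβ
  have hu : (n + K) / α * (K / β + 1) =
      K * (n / (α * β)) + n / α + K / α * (K / β + 1) := by
    field_simp
  have hl : (n / α - 1) * (K / β - 1) = K * (n / (α * β)) - n / α - K / β + 1 := by
    field_simp
    ring
  have hnα : n / α ≤ K * (ε * n) := by
    refine (div_le_self hnR hα).trans ?_
    nlinarith
  have h1 := le_abs_self (C₁ + K / α * (K / β + 1))
  have h2 := le_abs_self (C₂ + K / β)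
  have h3 := abs_nonneg (C₁ + K / α * (K / β + 1))
  have h4 := abs_nonneg (C₂ + K / β)
  have hcancel : K * (2 * ε * n + (|C₁ + K / α * (K / β + 1)| + |C₂ + K / β|) / K) =
      2 * (K * (ε * n)) + (|C₁ + K / α * (K / β + 1)| + |C₂ + K / β|) := by
    field_simp
  refine le_of_mul_le_mul_left ?_ hK0
  nth_rewrite 1 [← abs_of_pos hK0]
  rw [← abs_mul, hcancel, mul_sub, abs_le]
  constructor <;> linarith

/-- The number of representations of `n` by `⌊α * a⌋ + ⌊β * b⌋` is asymptotic to
`n / (α * β)`. -/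
theorem tendsto_ncard_beattyPairs_div {α β : ℝ} (hα : 1 ≤ α) (hβ : 1 ≤ β)
    (hα' : Irrational α) (hβ' : Irrational β)
    (hind : ∀ l m n : ℤ, n / α - m / β = l → m = 0 ∧ n = 0) :
    Tendsto (fun n : ℕ => ((beattyPairs α β n).ncard : ℝ) / n) atTop (nhds (1 / (α * β))) := by
  rw [Metric.tendsto_atTop]
  intro ε hε
  obtain ⟨C, hC⟩ := exists_abs_ncard_beattyPairs_sub_le hα hβ hα' hβ' hind
    (show 0 < ε / 4 by positivity)
  obtain ⟨N, hN⟩ := exists_nat_gt (2 * C / ε)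
  refine ⟨N + 1, fun n hn => ?_⟩
  have hn0 : (0 : ℝ) < n := by exact_mod_cast (by omega : 0 < n)
  have hNn : (N : ℝ) ≤ n := by exact_mod_cast (by omega : N ≤ n)
  have h := hC n (by omega)
  rw [div_lt_iff₀ hε] at hN
  rw [Real.dist_eq, ← mul_lt_mul_iff_of_pos_right hn0]
  nth_rewrite 2 [← abs_of_pos hn0]
  rw [← abs_mul, sub_mul, div_mul_cancel₀ _ hn0.ne', one_div_mul_eq_div]
  push_cast at h
  nlinarith

theorem sqrt_two_sqrt_three_independent (l m n : ℤ)
    (h : n / Real.sqrt 2 - m / Real.sqrt 3 = l) : m = 0 ∧ n = 0 := by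
  have h2 : Real.sqrt 2 ^ 2 = 2 := Real.sq_sqrt (by norm_num)
  have h3 : Real.sqrt 3 ^ 2 = 3 := Real.sq_sqrt (by norm_num)
  have h20 : Real.sqrt 2 ≠ 0 := by positivity
  have h30 : Real.sqrt 3 ≠ 0 := by positivity
  have h6 : Irrational (Real.sqrt 2 * Real.sqrt 3) := by
    rw [← Real.sqrt_mul (by norm_num), show (2 * 3 : ℝ) = ((6 : ℕ) : ℝ) by norm_num,
      irrational_sqrt_natCast_iff]
    rintro ⟨r, hr⟩
    have : r < 3 := by nlinarith
    interval_cases r <;> omega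
  have hlin : n * Real.sqrt 3 - m * Real.sqrt 2 = l * (Real.sqrt 2 * Real.sqrt 3) := by
    rw [← h]
    field_simp
  have hsq : (Real.sqrt 2 * Real.sqrt 3) * ((2 * (m * n) : ℤ) : ℝ) =
      ((3 * n ^ 2 + 2 * m ^ 2 - 6 * l ^ 2 : ℤ) : ℝ) := by
    have := congrArg (· ^ 2) hlin
    simp only [sub_sq, mul_pow, h2, h3] at this
    push_cast
    linarith
  have hmn : m * n = 0 := by
    by_contra hne
    exact (h6.mul_intCast (m := 2 * (m * n)) (by omega)).ne_int _ hsq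
  rcases mul_eq_zero.1 hmn with rfl | rfl
  · refine ⟨rfl, ?_⟩
    by_contra hn
    refine (irrational_sqrt_two.mul_intCast (m := l) ?_).ne_int n ?_
    · rintro rfl
      simp [hn] at h
    · simp only [Int.cast_zero, zero_div, sub_zero] at h
      rw [← h]
      field_simp
  · refine ⟨?_, rfl⟩
    by_contra hm
    refine (Nat.prime_three.irrational_sqrt.mul_intCast (m := l) ?_).ne_int (-m) ?_
    · rintro rfl
      simp [hm] at h
    · simp only [Int.cast_zero, zero_div, zero_sub] at h
      rw [← h]
      push_cast
      field_simp

theorem card_pnat_pairs_eq_ncard_beattyPairs (α β : ℝ) (n : ℤ) :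
    Nat.card {p : ℕ+ × ℕ+ // ⌊α * ((p.1 : ℕ) : ℝ)⌋ + ⌊β * ((p.2 : ℕ) : ℝ)⌋ = n} =
      (beattyPairs α β n).ncard := by
  let f : ℕ+ × ℕ+ → ℤ × ℤ := fun p => ((p.1 : ℕ), (p.2 : ℕ))
  have hf : Function.Injective f := by
    rintro ⟨a, b⟩ ⟨a', b'⟩ h
    simpa [f] using h
  have himage : beattyPairs α β n =
      f '' {p | ⌊α * ((p.1 : ℕ) : ℝ)⌋ + ⌊β * ((p.2 : ℕ) : ℝ)⌋ = n} := by
    ext ⟨a, b⟩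
    constructor
    · rintro ⟨h1, h2, h3⟩
      lift a to ℕ using le_of_lt h1
      lift b to ℕ using le_of_lt h2
      exact ⟨(⟨a, by simpa using h1⟩, ⟨b, by simpa using h2⟩), by simpa using h3, rfl⟩
    · rintro ⟨⟨a, b⟩, h, hab⟩
      obtain ⟨rfl, rfl⟩ := Prod.mk.inj hab
      exact ⟨by simp, by simp, by simpa using h⟩
  rw [himage, Set.ncard_image_of_injective _ hf]
  exact Nat.card_coe_set_eq _

/-- the number `r(n)` of pairs of positive integers `(a,b)` with
`n = ⌊√2·a⌋ + ⌊√3·b⌋` satisfies `r(n) ∼ n/√6`. -/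
theorem stmt_5 :
    Filter.Tendsto (fun n : ℕ =>
      (Nat.card {p : ℕ+ × ℕ+ //
          ⌊Real.sqrt 2 * ((p.1 : ℕ) : ℝ)⌋ + ⌊Real.sqrt 3 * ((p.2 : ℕ) : ℝ)⌋ = (n : ℤ)} : ℝ)
        / ((n : ℝ) / Real.sqrt 6))
      Filter.atTop (nhds 1) := by
  have h := (tendsto_ncard_beattyPairs_div (α := Real.sqrt 2) (β := Real.sqrt 3)
    (Real.one_le_sqrt.2 (by norm_num)) (Real.one_le_sqrt.2 (by norm_num)) irrational_sqrt_two
    Nat.prime_three.irrational_sqrt sqrt_two_sqrt_three_independent).mul_const (Real.sqrt 6)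
  have h6 : Real.sqrt 6 = Real.sqrt 2 * Real.sqrt 3 := by
    rw [← Real.sqrt_mul (by norm_num)]
    norm_num
  have hne : Real.sqrt 2 * Real.sqrt 3 ≠ 0 := by positivity
  rw [h6, one_div_mul_cancel hne] at h
  refine h.congr fun n => ?_
  rw [card_pnat_pairs_eq_ncard_beattyPairs, h6, div_div_eq_mul_div, div_mul_eq_mul_div]
end
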